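/- arXiv:1311.0757 — 6 statements merged into one kernel-verified Lean document; each statement's English description precedes it below -/
import Mathlib

section
/- Let m, n, j, k, u be natural numbers with m ≤ n, 1 ≤ j ≤ m−1, 1 ≤ k ≤ n−1, k < u and u ≤ j+k. Set e = m+n−1. Then ∑_{t=max(u,n)}^{e} (−1)^t · C(t−j−1, m−j−1) · C(t−k−1, n−k−1) · C(e−u, t−u) = 0 in ℤ. -/
open Polynomial in
/-- The alternating binomial sum of a polynomial over `[u, e]` vanishes if its degree is less than
`e - u`. -/
lemma sum_Icc_neg_one_pow_mul_eval_mul_choose_eq_zero {P : ℤ[X]} {u e : ℕ}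
    (hP : P.natDegree < e - u) :
    ∑ t ∈ Finset.Icc u e, (-1 : ℤ) ^ t * P.eval (t : ℤ) * ((e - u).choose (t - u)) = 0 := by
  obtain ⟨N, rfl⟩ := Nat.exists_eq_add_of_le (show u ≤ e by lia)
  rw [Nat.add_sub_cancel_left] at hP ⊢
  have hdiff := congrFun (fwdDiff_iter_eq_zero_of_degree_lt hP) (u : ℤ)
  rw [fwdDiff_iter_eq_sum_shift] at hdiff
  rw [← Finset.Ico_add_one_right_eq_Icc, Finset.sum_Ico_eq_sum_range,
    show u + N + 1 - u = N + 1 by lia]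
  have hscale := congrArg ((-1 : ℤ) ^ (u + N) * ·) hdiff
  simp only [Finset.mul_sum, Pi.zero_apply, mul_zero] at hscale
  rw [← hscale]
  refine Finset.sum_congr rfl fun i hi => ?_
  have hi' : i ≤ N := by simpa [Nat.lt_succ_iff] using hi
  have hsign : (-1 : ℤ) ^ (u + N) * (-1) ^ (N - i) = (-1) ^ (u + i) := by
    rw [← pow_add, show u + N + (N - i) = (u + i) + 2 * (N - i) by lia, pow_add, pow_mul]
    simp
  rw [← hsign, Nat.add_sub_cancel_left]
  simp only [nsmul_eq_mul, mul_one, smul_eq_mul, Nat.cast_add]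
  ring

open Polynomial in
lemma eval_descPochhammer_comp_X_sub_C {b c t : ℕ} (h : c ≤ t) :
    ((descPochhammer ℤ b).comp (X - C (c : ℤ))).eval (t : ℤ) =
      b.factorial * (t - c).choose b := by
  rw [eval_comp, eval_sub, eval_X, eval_C, ← Nat.cast_sub h,
    descPochhammer_eval_eq_descFactorial, Nat.descFactorial_eq_factorial_mul_choose, Nat.cast_mul]


theorem products_case_J_not_subset_K
    (m n j k u : ℕ) (hmn : m ≤ n)
    (hj1 : 1 ≤ j) (hj2 : j ≤ m - 1)
    (hk1 : 1 ≤ k) (hk2 : k ≤ n - 1)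
    (hku : k < u) (hujk : u ≤ j + k) :
    ∑ t ∈ Finset.Icc (max u n) (m + n - 1),
      (-1 : ℤ) ^ t * ((t - j - 1).choose (m - j - 1)) *
        ((t - k - 1).choose (n - k - 1)) *
        (((m + n - 1) - u).choose (t - u)) = 0 := by
  set P : Polynomial ℤ :=
    (descPochhammer ℤ (m - j - 1)).comp (.X - .C ((j + 1 : ℕ) : ℤ)) *
      (descPochhammer ℤ (n - k - 1)).comp (.X - .C ((k + 1 : ℕ) : ℤ)) with hP
  have hdeg : P.natDegree < (m + n - 1) - u := by
    refine Polynomial.natDegree_mul_le.trans_lt ?_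
    simp only [Polynomial.natDegree_comp, descPochhammer_natDegree, Polynomial.natDegree_X_sub_C]
    lia
  have hfact : ((m - j - 1).factorial * (n - k - 1).factorial : ℤ) ≠ 0 := by positivity
  refine (mul_eq_zero.mp ?_).resolve_left hfact
  rw [← sum_Icc_neg_one_pow_mul_eval_mul_choose_eq_zero hdeg, Finset.mul_sum]
  refine (Finset.sum_congr rfl fun t ht => ?_).trans
    (Finset.sum_subset (Finset.Icc_subset_Icc_left (le_max_left u n)) fun t ht ht' => ?_)
  · have hnt : n ≤ t := (le_max_right u n).trans (Finset.mem_Icc.mp ht).1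
    rw [hP, Polynomial.eval_mul, eval_descPochhammer_comp_X_sub_C (by lia),
      eval_descPochhammer_comp_X_sub_C (by lia), ← Nat.sub_sub, ← Nat.sub_sub]
    ring
  · simp only [Finset.mem_Icc, max_le_iff, not_and] at ht ht'
    have htn : t < n := by lia
    rw [hP, Polynomial.eval_mul, eval_descPochhammer_comp_X_sub_C (b := n - k - 1) (by lia),
      Nat.choose_eq_zero_of_lt (by lia : t - (k + 1) < n - k - 1)]
    simp
end

section
/- Let m, n, j, k be natural numbers with m ≤ n, 1 ≤ j ≤ m−1, m ≤ k ≤ n−1 and j < k. Set e = m+n−1. Then (−1)^{k} · (−1)^{m−1−j} · C(k−j−1, m−j−1) + ∑_{t=n}^{e} (−1)^t · (−1)^{m+n−j−k} · C(t−j−1, m−j−1) · C(t−k−1, n−k−1) · C(e−k, t−k) = 0 in ℤ. -/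
/-- The alternating binomial sum of order `N` annihilates polynomials of degree less than `N`. -/
theorem Polynomial.sum_neg_one_pow_mul_choose_mul_eval_eq_zero {R : Type*} [CommRing R]
    {P : Polynomial R} {N : ℕ} (hP : P.natDegree < N) :
    ∑ s ∈ Finset.range (N + 1), (-1 : R) ^ s * (N.choose s : R) * P.eval (s : R) = 0 := by
  have h := congrFun (Polynomial.fwdDiff_iter_eq_zero_of_degree_lt hP) 0
  rw [fwdDiff_iter_eq_sum_shift] at h
  have h' := congrArg (fun x => (-1 : R) ^ N * x) h
  simp only [Pi.zero_apply, mul_zero, Finset.mul_sum] at h'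
  rw [← h']
  refine Finset.sum_congr rfl fun s hs => ?_
  obtain ⟨r, rfl⟩ := Nat.exists_eq_add_of_le (Finset.mem_range_succ_iff.mp hs)
  have hsq : (-1 : R) ^ r * (-1) ^ r = 1 := by rw [← mul_pow]; simp
  simp only [zsmul_eq_mul, nsmul_eq_mul, mul_one, zero_add, add_tsub_cancel_left]
  push_cast
  rw [pow_add]
  linear_combination (-(-1 : R) ^ s * ((s + r).choose s : R) * P.eval (s : R)) * hsq

theorem descPochhammer_eval_neg_one (R : Type*) [CommRing R] (a : ℕ) :
    (descPochhammer R a).eval (-1) = (-1) ^ a * (a.factorial : R) := by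
  induction a with
  | zero => simp
  | succ a ih =>
    rw [descPochhammer_succ_eval, ih, Nat.factorial_succ]
    push_cast
    ring

theorem Int.sum_neg_one_pow_mul_choose_mul_choose_mul_choose {a b N : ℕ} (d : ℕ)
    (h : a + b < N) :
    ∑ s ∈ Finset.range N, (-1 : ℤ) ^ s * N.choose (s + 1) * s.choose a * (s + 1 + d).choose b
      = (-1) ^ a * d.choose b := by
  have hdeg : ((descPochhammer ℤ a).comp (Polynomial.X - Polynomial.C 1) *
      (descPochhammer ℤ b).comp (Polynomial.X + Polynomial.C (d : ℤ))).natDegree < N := by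
    refine Polynomial.natDegree_mul_le.trans_lt ?_
    simpa only [Polynomial.natDegree_comp, descPochhammer_natDegree, Polynomial.natDegree_X_sub_C,
      Polynomial.natDegree_X_add_C, mul_one] using h
  have hsum := Polynomial.sum_neg_one_pow_mul_choose_mul_eval_eq_zero hdeg
  have hcast (x y : ℕ) :
      (descPochhammer ℤ y).eval (x : ℤ) = (y.factorial : ℤ) * x.choose y := by
    rw [descPochhammer_eval_eq_descFactorial, Nat.descFactorial_eq_factorial_mul_choose]
    push_cast
    rfl
  have hne : (a.factorial : ℤ) * b.factorial ≠ 0 := by positivity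
  rw [Finset.sum_range_succ'] at hsum
  simp only [Polynomial.eval_mul, Polynomial.eval_comp, Polynomial.eval_sub, Polynomial.eval_add,
    Polynomial.eval_X, Polynomial.eval_C, Nat.cast_zero, zero_sub, zero_add,
    descPochhammer_eval_neg_one, hcast, pow_zero, Nat.choose_zero_right, Nat.cast_one,
    one_mul] at hsum
  apply mul_left_cancel₀ hne
  rw [← sub_eq_zero, ← neg_eq_zero, ← hsum, neg_sub, sub_eq_add_neg, add_comm, Finset.mul_sum,
    ← Finset.sum_neg_distrib]
  congr 1
  · refine Finset.sum_congr rfl fun s _ => ?_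
    have h1 : ((s + 1 : ℕ) : ℤ) - 1 = (s : ℕ) := by push_cast; ring
    rw [h1, ← Nat.cast_add, hcast, hcast]
    ring
  · ring

theorem products_case_J_subset_K_m_le_card_K
    (m n j k : ℕ) (hmn : m ≤ n)
    (hj1 : 1 ≤ j) (hj2 : j ≤ m - 1)
    (hk1 : m ≤ k) (hk2 : k ≤ n - 1) (hjk : j < k) :
    (-1 : ℤ) ^ k * (-1 : ℤ) ^ (m - 1 - j) * ((k - j - 1).choose (m - j - 1))
      + ∑ t ∈ Finset.Icc n (m + n - 1),
          (-1 : ℤ) ^ t * (-1 : ℤ) ^ (m + n - j - k) *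
            ((t - j - 1).choose (m - j - 1)) * ((t - k - 1).choose (n - k - 1)) *
            (((m + n - 1) - k).choose (t - k)) = 0 := by
  obtain ⟨b, rfl⟩ : ∃ b, m = j + 1 + b := Nat.exists_eq_add_of_le (by omega)
  obtain ⟨d, rfl⟩ : ∃ d, k = j + 1 + d := Nat.exists_eq_add_of_le (by omega)
  obtain ⟨a, rfl⟩ : ∃ a, n = j + 1 + d + 1 + a := Nat.exists_eq_add_of_le (by omega)
  have key := Int.sum_neg_one_pow_mul_choose_mul_choose_mul_choose d
    (show a + b < a + b + j + 1 by omega)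
  rw [Finset.range_eq_Ico, ← Finset.sum_Ico_consecutive _ (Nat.zero_le a)
    (show a ≤ a + b + j + 1 by omega), Finset.sum_eq_zero, zero_add] at key
  swap
  · intro s hs
    simp [Nat.choose_eq_zero_of_lt (Finset.mem_Ico.mp hs).2]
  have hIcc : Finset.Icc (j + 1 + d + 1 + a) (j + 1 + b + (j + 1 + d + 1 + a) - 1) =
      Finset.Ico (a + (j + d + 2)) (a + b + j + 1 + (j + d + 2)) := by
    ext t
    simp only [Finset.mem_Icc, Finset.mem_Ico]
    omega
  have ha : (-1 : ℤ) ^ a * (-1) ^ a = 1 := by rw [← mul_pow]; simp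
  rw [hIcc, ← Finset.sum_Ico_add']
  have hterm : ∀ s ∈ Finset.Ico a (a + b + j + 1),
      (-1 : ℤ) ^ (s + (j + d + 2)) * (-1 : ℤ) ^ (j + 1 + b + (j + 1 + d + 1 + a) - j - (j + 1 + d)) *
        ((s + (j + d + 2) - j - 1).choose (j + 1 + b - j - 1)) *
        ((s + (j + d + 2) - (j + 1 + d) - 1).choose (j + 1 + d + 1 + a - (j + 1 + d) - 1)) *
        ((j + 1 + b + (j + 1 + d + 1 + a) - 1 - (j + 1 + d)).choose
          (s + (j + d + 2) - (j + 1 + d))) =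
      (-1) ^ (j + d + a + b) * ((-1 : ℤ) ^ s * (a + b + j + 1).choose (s + 1) * s.choose a *
        (s + 1 + d).choose b) := by
    intro s _
    rw [show j + 1 + b + (j + 1 + d + 1 + a) - j - (j + 1 + d) = a + b + 2 by omega,
      show s + (j + d + 2) - j - 1 = s + 1 + d by omega,
      show j + 1 + b - j - 1 = b by omega,
      show s + (j + d + 2) - (j + 1 + d) - 1 = s by omega,
      show j + 1 + d + 1 + a - (j + 1 + d) - 1 = a by omega,
      show j + 1 + b + (j + 1 + d + 1 + a) - 1 - (j + 1 + d) = a + b + j + 1 by omega,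
      show s + (j + d + 2) - (j + 1 + d) = s + 1 by omega]
    ring
  rw [Finset.sum_congr rfl hterm, ← Finset.mul_sum, key,
    show j + 1 + b - 1 - j = b by omega, show j + 1 + d - j - 1 = d by omega,
    show j + 1 + b - j - 1 = b by omega]
  simp only [pow_add, pow_one]
  linear_combination ((-1 : ℤ) ^ j * (-1) ^ d * (-1) ^ b * d.choose b) * ha
end

section
/- Let m, n, j, k be natural numbers with m ≤ n and 1 ≤ j < k ≤ m−1. Set e = m+n−1. Then ∑_{t=n}^{e} (−1)^t · C(t−j−1, m−j−1) · C(t−k−1, n−k−1) · C(e−k, t−k) = 0 in ℤ. -/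
theorem Polynomial.alternating_sum_range_choose_mul_eval_eq_zero {R : Type*} [CommRing R]
    {P : Polynomial R} {N : ℕ} (hP : P.natDegree < N) :
    ∑ s ∈ Finset.range (N + 1), (-1 : R) ^ s * N.choose s * P.eval (s : R) = 0 := by
  have h := congrFun (Polynomial.fwdDiff_iter_eq_zero_of_degree_lt hP) 0
  rw [fwdDiff_iter_eq_sum_shift, Pi.zero_apply] at h
  calc ∑ s ∈ Finset.range (N + 1), (-1 : R) ^ s * N.choose s * P.eval (s : R)
      = (-1) ^ N * ∑ s ∈ Finset.range (N + 1),
          ((-1 : ℤ) ^ (N - s) * N.choose s) • P.eval (0 + s • (1 : R)) := by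
        rw [Finset.mul_sum]
        refine Finset.sum_congr rfl fun s hs => ?_
        obtain ⟨d, rfl⟩ := Nat.exists_eq_add_of_le (Finset.mem_range_succ_iff.mp hs)
        have hd : (-1 : R) ^ d * (-1) ^ d = 1 := by rw [← mul_pow]; simp
        simp only [zsmul_eq_mul, nsmul_eq_mul, zero_add, mul_one, Nat.add_sub_cancel_left,
          pow_add]
        push_cast
        linear_combination (-(-1 : R) ^ s * (s + d).choose s * P.eval (s : R)) * hd
    _ = 0 := by rw [h, mul_zero]

theorem alternating_sum_range_choose_add_mul_choose_sub_one {a b c N : ℕ} (hca : c < a)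
    (hN : a + b < N) :
    ∑ s ∈ Finset.range (N + 1),
      (-1 : ℤ) ^ s * (s + c).choose a * (s - 1).choose b * N.choose s = 0 := by
  let A : Polynomial ℤ := (descPochhammer ℤ a).comp (Polynomial.X + Polynomial.C (c : ℤ))
  let B : Polynomial ℤ := (descPochhammer ℤ b).comp (Polynomial.X - Polynomial.C 1)
  have hdeg : (A * B).natDegree < N := by
    refine lt_of_le_of_lt Polynomial.natDegree_mul_le ?_
    simpa only [A, B, Polynomial.natDegree_comp, descPochhammer_natDegree,
      Polynomial.natDegree_X_add_C, Polynomial.natDegree_X_sub_C, mul_one] using hN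
  have hA (s : ℕ) : A.eval (s : ℤ) = a.factorial * (s + c).choose a := by
    have h := descPochhammer_eval_eq_descFactorial ℤ (s + c) a
    rw [Nat.descFactorial_eq_factorial_mul_choose] at h
    simpa [A] using h
  have hB (s : ℕ) : B.eval ((s + 1 : ℕ) : ℤ) = b.factorial * s.choose b := by
    have h := descPochhammer_eval_eq_descFactorial ℤ s b
    rw [Nat.descFactorial_eq_factorial_mul_choose] at h
    simpa [B] using h
  have hne : (a.factorial * b.factorial : ℤ) ≠ 0 := by positivity
  refine (mul_eq_zero.mp ?_).resolve_left hne
  rw [← Polynomial.alternating_sum_range_choose_mul_eval_eq_zero hdeg, Finset.mul_sum]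
  refine Finset.sum_congr rfl fun s _ => ?_
  rw [Polynomial.eval_mul, hA]
  cases s with
  | zero => simp [Nat.choose_eq_zero_of_lt hca]
  | succ s =>
    rw [hB, Nat.add_sub_cancel]
    ring

theorem products_case_J_proper_subset_K_card_K_lt_m
    (m n j k : ℕ) (hmn : m ≤ n)
    (hj1 : 1 ≤ j) (hjk : j < k) (hk2 : k ≤ m - 1) :
    ∑ t ∈ Finset.Icc n (m + n - 1),
      (-1 : ℤ) ^ t * ((t - j - 1).choose (m - j - 1)) *
        ((t - k - 1).choose (n - k - 1)) *
        (((m + n - 1) - k).choose (t - k)) = 0 := by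
  have h := alternating_sum_range_choose_add_mul_choose_sub_one
    (a := m - j - 1) (b := n - k - 1) (c := k - j - 1) (N := m + n - 1 - k)
    (by omega) (by omega)
  rw [← mul_zero ((-1 : ℤ) ^ k), ← h, Finset.mul_sum]
  refine Finset.sum_of_injOn (fun t => t - k) ?_ ?_ ?_ ?_
  · intro x hx y hy hxy
    simp only [Finset.coe_Icc, Set.mem_Icc] at hx hy hxy
    omega
  · intro t ht
    simp only [Finset.coe_Icc, Set.mem_Icc, Finset.coe_range, Set.mem_Iio] at ht ⊢
    omega
  · intro s hs hs'
    have hlt : s + k < n := by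
      by_contra! hle
      refine hs' ⟨s + k, ?_, Nat.add_sub_cancel s k⟩
      simp only [Finset.coe_Icc, Set.mem_Icc, Finset.mem_range] at hs ⊢
      omega
    obtain rfl | hs0 := Nat.eq_zero_or_pos s
    · simp [Nat.choose_eq_zero_of_lt (show k - j - 1 < m - j - 1 by omega)]
    · simp [Nat.choose_eq_zero_of_lt (show s - 1 < n - k - 1 by omega)]
  · intro t ht
    obtain ⟨s, rfl⟩ := Nat.exists_eq_add_of_le (show k ≤ t by
      have := (Finset.mem_Icc.mp ht).1
      omega)
    have := (Finset.mem_Icc.mp ht).1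
    rw [Nat.add_sub_cancel_left, show k + s - j - 1 = s + (k - j - 1) by omega, pow_add]
    ring
end

section
/- Let m, n, k be natural numbers with m ≤ n and 1 ≤ k ≤ m−1. Set e = m+n−1. Then ∑_{t=n}^{e} (−1)^t · C(t−k−1, m−k−1) · C(t−k−1, n−k−1) · C(e−k, t−k) = (−1)^{k+m+n+1} in ℤ. -/
theorem descPochhammer_int_eval_neg_one (a : ℕ) :
    (descPochhammer ℤ a).eval (-1) = (-1) ^ a * (a.factorial : ℤ) := by
  have h := ascPochhammer_eval_neg_eq_descPochhammer ℤ (-1) a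
  rw [neg_neg, ascPochhammer_eval_one] at h
  rw [h, ← mul_assoc, ← pow_add, Even.neg_one_pow ⟨a, rfl⟩, one_mul]

theorem descPochhammer_int_eval_natCast (a j : ℕ) :
    (descPochhammer ℤ a).eval (j : ℤ) = (a.factorial : ℤ) * (j.choose a : ℤ) := by
  rw [descPochhammer_eval_eq_descFactorial, Nat.descFactorial_eq_factorial_mul_choose,
    Nat.cast_mul]

theorem alternating_sum_choose_mul_choose_mul_choose_succ {a b N : ℕ} (h : a + b < N) :
    ∑ j ∈ Finset.range N,
      (-1 : ℤ) ^ j * (j.choose a : ℤ) * (j.choose b : ℤ) * (N.choose (j + 1) : ℤ) =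
        (-1) ^ (a + b) := by
  have hdeg : (descPochhammer ℤ a * descPochhammer ℤ b).natDegree < N := by
    refine Polynomial.natDegree_mul_le.trans_lt ?_
    rwa [descPochhammer_natDegree, descPochhammer_natDegree]
  have hΔ := congrFun (Polynomial.fwdDiff_iter_eq_zero_of_degree_lt hdeg) (-1)
  rw [fwdDiff_iter_eq_sum_shift, Finset.sum_range_succ'] at hΔ
  have hfact : ((a.factorial : ℤ) * b.factorial * (-1) ^ N) ≠ 0 := by
    have := a.factorial_ne_zero
    have := b.factorial_ne_zero
    simp [*]
  apply mul_left_cancel₀ hfact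
  rw [Finset.mul_sum, ← sub_eq_zero, ← neg_eq_zero, neg_sub, sub_eq_add_neg, add_comm,
    ← Finset.sum_neg_distrib]
  refine Eq.trans ?_ hΔ
  congr 1
  · refine Finset.sum_congr rfl fun j hj ↦ ?_
    have hsign : (-1 : ℤ) ^ N * (-1) ^ j = -(-1) ^ (N - (j + 1)) := by
      obtain ⟨d, rfl⟩ := Nat.exists_eq_add_of_lt (Finset.mem_range.mp hj)
      rw [show j + d + 1 - (j + 1) = d by lia, show j + d + 1 = j + (d + 1) by lia, pow_add,
        mul_right_comm, ← pow_add, Even.neg_one_pow ⟨j, rfl⟩]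
      ring
    have hshift : (-1 : ℤ) + (j + 1) • 1 = j := by simp
    rw [hshift, Polynomial.eval_mul, descPochhammer_int_eval_natCast,
      descPochhammer_int_eval_natCast, smul_eq_mul]
    linear_combination
      -(a.factorial * b.factorial * j.choose a * j.choose b * N.choose (j + 1) : ℤ) * hsign
  · simp only [Nat.sub_zero, Nat.choose_zero_right, zero_smul, add_zero, Polynomial.eval_mul,
      descPochhammer_int_eval_neg_one, smul_eq_mul, pow_add]
    push_cast
    ring

theorem products_case_J_eq_K_card_K_lt_m
    (m n k : ℕ) (hmn : m ≤ n)
    (hk1 : 1 ≤ k) (hk2 : k ≤ m - 1) :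
    ∑ t ∈ Finset.Icc n (m + n - 1),
      (-1 : ℤ) ^ t * ((t - k - 1).choose (m - k - 1)) *
        ((t - k - 1).choose (n - k - 1)) *
        (((m + n - 1) - k).choose (t - k)) = (-1 : ℤ) ^ (k + m + n + 1) := by
  have hsub : Finset.Icc n (m + n - 1) ⊆ Finset.Ico (k + 1) (m + n) := by
    intro t ht
    rw [Finset.mem_Icc] at ht
    rw [Finset.mem_Ico]
    lia
  rw [Finset.sum_subset hsub fun t ht hnt ↦ ?_]
  · rw [Finset.sum_Ico_eq_sum_range]
    have h := alternating_sum_choose_mul_choose_mul_choose_succ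
      (a := m - k - 1) (b := n - k - 1) (N := m + n - 1 - k) (by lia)
    rw [show k + m + n + 1 = (k + 1) + (m - k - 1 + (n - k - 1)) + 2 * (k + 1) by lia,
      pow_add _ _ (2 * (k + 1)), (even_two_mul (k + 1)).neg_one_pow, mul_one, pow_add, ← h,
      Finset.mul_sum, show m + n - (k + 1) = m + n - 1 - k by lia]
    refine Finset.sum_congr rfl fun j _ ↦ ?_
    rw [show k + 1 + j - k - 1 = j by lia, show k + 1 + j - k = j + 1 by lia, pow_add]
    ring
  · rw [Finset.mem_Ico] at ht
    rw [Finset.mem_Icc] at hnt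
    rw [Nat.choose_eq_zero_of_lt (show t - k - 1 < n - k - 1 by lia)]
    simp
end

section
/- Let n, e, j, w be natural numbers with e ≥ 2, 1 ≤ j ≤ n−e, and n−j−e+1 ≤ w ≤ n+1−j. Then ∑_{t=0}^{n+1} (−1)^t · binom((t:ℤ)−j−1, n−j−e) · C(w, n+1−t) = 0 in ℤ, where binom(x,d) denotes the generalized binomial coefficient x(x−1)⋯(x−d+1)/d! for x ∈ ℤ and d ∈ ℕ. -/
open scoped fwdDiff in
theorem fwdDiff_ringChoose_succ {R : Type*} [Ring R] [BinomialRing R] (d : ℕ) :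
    Δ_[1] (fun x : R ↦ Ring.choose x (d + 1)) = fun x ↦ Ring.choose x d := by
  ext x
  simp [fwdDiff, Ring.choose_succ_succ]

theorem fwdDiff_iter_ringChoose_eq_zero {R : Type*} [Ring R] [BinomialRing R] {d w : ℕ}
    (h : d < w) : (fwdDiff 1)^[w] (fun x : R ↦ Ring.choose x d) = 0 := by
  induction w generalizing d with
  | zero => omega
  | succ w ih =>
    rw [Function.iterate_succ_apply]
    cases d with
    | zero =>
      ext x
      simp [fwdDiff_iter_eq_sum_shift]
    | succ d =>
      rw [fwdDiff_ringChoose_succ]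
      exact ih (by omega)

theorem sum_neg_one_pow_mul_ringChoose_mul_choose_eq_zero {d w : ℕ} (h : d < w) (y : ℤ) :
    ∑ k ∈ Finset.range (w + 1), (-1 : ℤ) ^ k * Ring.choose (y + k) d * w.choose k = 0 := by
  have hz := congrFun (fwdDiff_iter_ringChoose_eq_zero (R := ℤ) h) y
  rw [fwdDiff_iter_eq_sum_shift, Pi.zero_apply] at hz
  rw [← mul_zero ((-1 : ℤ) ^ w), ← hz, Finset.mul_sum]
  refine Finset.sum_congr rfl fun k hk ↦ ?_
  have hkw : k ≤ w := Finset.mem_range_succ_iff.mp hk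
  have hs : (-1 : ℤ) ^ w * (-1) ^ (w - k) = (-1) ^ k := by
    rw [← pow_add, show w + (w - k) = 2 * (w - k) + k by omega, pow_add, pow_mul]
    simp
  rw [← hs]
  simp only [nsmul_eq_mul, smul_eq_mul, mul_one]
  ring

theorem blowup_alternating_sum_cJK_vanishes
    (n e j w : ℕ) (he : 2 ≤ e) (hj1 : 1 ≤ j) (hj2 : j ≤ n - e)
    (hw1 : n - j - e + 1 ≤ w) (hw2 : w ≤ n + 1 - j) :
    ∑ t ∈ Finset.range (n + 2),
      (-1 : ℤ) ^ t * Ring.choose ((t : ℤ) - j - 1) (n - j - e) *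
        (w.choose (n + 1 - t)) = 0 := by
  obtain ⟨m, hm⟩ : ∃ m, n + 1 = m + w := ⟨n + 1 - w, by omega⟩
  rw [show n + 2 = m + (w + 1) by omega, Finset.sum_range_add, Finset.sum_eq_zero, zero_add]
  · rw [← mul_zero ((-1 : ℤ) ^ m),
      ← sum_neg_one_pow_mul_ringChoose_mul_choose_eq_zero hw1 ((m : ℤ) - j - 1), Finset.mul_sum]
    refine Finset.sum_congr rfl fun k hk ↦ ?_
    have hkw : k ≤ w := Finset.mem_range_succ_iff.mp hk
    rw [show n + 1 - (m + k) = w - k by omega, Nat.choose_symm hkw,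
      show ((m + k : ℕ) : ℤ) - j - 1 = (m : ℤ) - j - 1 + k by push_cast; ring, pow_add]
    ring
  · intro t ht
    have htm : t < m := Finset.mem_range.mp ht
    rw [Nat.choose_eq_zero_of_lt (by omega), Nat.cast_zero, mul_zero]
end

section
/- Let n, e, j, w, t be natural numbers with e ≥ 2, 1 ≤ j ≤ n−e, w ≤ n+1−j, and 0 ≤ t ≤ n−e. Then (−1)^{n−j−e} · binom((t:ℤ)−j−1, n−j−e) · C(w, n+1−t) equals 1 if t = j and w = n+1−j, and equals 0 otherwise. -/
theorem Ring.choose_neg_one_int (d : ℕ) : Ring.choose (-1 : ℤ) d = (-1) ^ d := by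
  have h : Ring.choose ((1 : ℤ) + d - 1) d = 1 := by
    rw [add_sub_cancel_left, Ring.choose_natCast, Nat.choose_self, Nat.cast_one]
  rw [Ring.choose_neg, h, Units.smul_def]
  simp [Int.negOnePow_def]

theorem blowup_cJK_low_range
    (n e j w t : ℕ) (he : 2 ≤ e) (hj1 : 1 ≤ j) (hj2 : j ≤ n - e)
    (hw : w ≤ n + 1 - j) (ht : t ≤ n - e) :
    (-1 : ℤ) ^ (n - j - e) * Ring.choose ((t : ℤ) - j - 1) (n - j - e) *
        (w.choose (n + 1 - t)) =
      if t = j ∧ w = n + 1 - j then 1 else 0 := by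
  rcases lt_trichotomy t j with h | rfl | h
  · rw [Nat.choose_eq_zero_of_lt (by omega), if_neg (by omega)]
    simp
  · rw [sub_self, zero_sub, Ring.choose_neg_one_int, ← mul_pow]
    rcases hw.lt_or_eq with hlt | rfl
    · rw [Nat.choose_eq_zero_of_lt hlt, if_neg (by omega)]
      simp
    · simp
  · have hcast : (t : ℤ) - j - 1 = ((t - j - 1 : ℕ) : ℤ) := by omega
    rw [hcast, Ring.choose_natCast, Nat.choose_eq_zero_of_lt (by omega), if_neg (by omega)]
    simp
end
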